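/- The serial and parallel a-posteriori transition distributions coincide: for every t ∈ {1,…,L}, every pair of states m′, m ∈ S, and every observation sequence y with P(Y = y) > 0, one has P(S_{t−1} = m′, S_t = m | Y = y) = P(S_{t−1} = m′, S_t = m | Y_{i(t)} = y|_{i(t)}). -/

import Mathlib

/-!
Finite hidden Markov source over a memoryless channel.
States `S` (with distinguished state `0`), channel output symbols `O`.
A state path is `s : Fin (L+1) → S`; an observation sequence is `y : Fin L → O`,
where index `t : Fin L` represents time `t+1 ∈ {1,…,L}`.
-/

open scoped Classical in
/-- The probability of an event `A` under the mass function `P`. -/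
noncomputable def prob {S O : Type*} [Fintype S] [Fintype O] {L : ℕ}
    (P : (Fin (L + 1) → S) × (Fin L → O) → ℝ)
    (A : (Fin (L + 1) → S) × (Fin L → O) → Prop) : ℝ :=
  ∑ sy : (Fin (L + 1) → S) × (Fin L → O), if A sy then P sy else 0

/-- The conditional probability `P(A | B)`. -/
noncomputable def condProb {S O : Type*} [Fintype S] [Fintype O] {L : ℕ}
    (P : (Fin (L + 1) → S) × (Fin L → O) → ℝ)
    (A B : (Fin (L + 1) → S) × (Fin L → O) → Prop) : ℝ :=
  prob P (fun sy => A sy ∧ B sy) / prob P B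

/-- The trajectory that follows `u` on the time segment from `a` to `b` and `v` elsewhere. -/
def splice {S O : Type*} {L : ℕ} (a b : ℕ) (u v : (Fin (L + 1) → S) × (Fin L → O)) :
    (Fin (L + 1) → S) × (Fin L → O) :=
  (fun j => if a ≤ (j : ℕ) ∧ (j : ℕ) ≤ b then u.1 j else v.1 j,
    fun k => if a < (k : ℕ) + 1 ∧ (k : ℕ) + 1 ≤ b then u.2 k else v.2 k)

theorem splice_splice {S O : Type*} {L : ℕ} (a b : ℕ) (u v : (Fin (L + 1) → S) × (Fin L → O)) :
    splice a b (splice a b u v) (splice a b v u) = u := by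
  ext j <;> simp only [splice] <;> split_ifs <;> rfl

/-- Exchanging the segments from `a` to `b` of two trajectories, as a permutation of pairs. -/
def spliceEquiv {S O : Type*} {L : ℕ} (a b : ℕ) :
    Equiv.Perm (((Fin (L + 1) → S) × (Fin L → O)) × ((Fin (L + 1) → S) × (Fin L → O))) where
  toFun x := (splice a b x.1 x.2, splice a b x.2 x.1)
  invFun x := (splice a b x.1 x.2, splice a b x.2 x.1)
  left_inv x := by simp only [splice_splice]
  right_inv x := by simp only [splice_splice]

/-- Trajectories that agree at the times `a` and `b` may exchange their segments between these
times without changing the product of their Markov weights. -/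
theorem weight_splice_mul {S O : Type*} [Zero S] [DecidableEq S] {L : ℕ}
    (p : S → S → ℝ) (q : O → S → S → ℝ) (P : (Fin (L + 1) → S) × (Fin L → O) → ℝ)
    (hP : ∀ s y, P (s, y) =
      (if s 0 = 0 then (1 : ℝ) else 0) *
        ∏ t : Fin L, p (s t.castSucc) (s t.succ) * q (y t) (s t.castSucc) (s t.succ))
    (a b : Fin (L + 1)) (u v : (Fin (L + 1) → S) × (Fin L → O))
    (ha : u.1 a = v.1 a) (hb : u.1 b = v.1 b) :
    P (splice a b u v) * P (splice a b v u) = P u * P v := by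
  obtain ⟨s, y⟩ := u
  obtain ⟨s', y'⟩ := v
  have key : ∀ j : Fin (L + 1), ((j : ℕ) ≤ a ∨ (b : ℕ) ≤ j) →
      ∀ x z : (Fin (L + 1) → S) × (Fin L → O),
      x.1 a = z.1 a → x.1 b = z.1 b → (splice a b x z).1 j = z.1 j := by
    intro j hj x z hxa hxb
    simp only [splice]
    split_ifs with h
    · rcases hj with hj | hj
      · rwa [show j = a from Fin.ext (by omega)]
      · rwa [show j = b from Fin.ext (by omega)]
    · rfl
  have hstep : ∀ x z : (Fin (L + 1) → S) × (Fin L → O), P x * P z =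
      ((if x.1 0 = 0 then (1 : ℝ) else 0) * (if z.1 0 = 0 then (1 : ℝ) else 0)) *
        ∏ t : Fin L, (p (x.1 t.castSucc) (x.1 t.succ) * q (x.2 t) (x.1 t.castSucc) (x.1 t.succ)) *
          (p (z.1 t.castSucc) (z.1 t.succ) * q (z.2 t) (z.1 t.castSucc) (z.1 t.succ)) := by
    rintro ⟨x, x'⟩ ⟨z, z'⟩
    rw [hP, hP, mul_mul_mul_comm, ← Finset.prod_mul_distrib]
  rw [hstep, hstep]
  congr 1
  · simp only [splice]
    split_ifs <;> simp
  · refine Finset.prod_congr rfl fun t _ => ?_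
    by_cases h : (a : ℕ) < (t : ℕ) + 1 ∧ (t : ℕ) + 1 ≤ b
    · have h₁ : (a : ℕ) ≤ (t : ℕ) ∧ (t : ℕ) ≤ b := by omega
      have h₂ : (a : ℕ) ≤ (t : ℕ) + 1 ∧ (t : ℕ) + 1 ≤ b := by omega
      simp only [splice, Fin.val_castSucc, Fin.val_succ, if_pos h, if_pos h₁, if_pos h₂]
    · have h₁ : (t.castSucc : ℕ) ≤ a ∨ (b : ℕ) ≤ t.castSucc := by
        simp only [Fin.val_castSucc]; omega
      have h₂ : (t.succ : ℕ) ≤ a ∨ (b : ℕ) ≤ t.succ := by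
        simp only [Fin.val_succ]; omega
      have hy : ∀ x z : (Fin (L + 1) → S) × (Fin L → O), (splice a b x z).2 t = z.2 t :=
        fun x z => if_neg h
      rw [key _ h₁ _ _ ha hb, key _ h₂ _ _ ha hb, key _ h₁ _ _ ha.symm hb.symm,
        key _ h₂ _ _ ha.symm hb.symm, hy, hy, mul_comm]

/-- A weight-preserving permutation of pairs that maps `A × B` onto `C × D` identifies the products
of the probabilities. -/
theorem prob_mul_prob_of_perm {S O : Type*} [Fintype S] [Fintype O] {L : ℕ}
    (P : (Fin (L + 1) → S) × (Fin L → O) → ℝ)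
    (e : Equiv.Perm (((Fin (L + 1) → S) × (Fin L → O)) × ((Fin (L + 1) → S) × (Fin L → O))))
    (he : ∀ x, P (e x).1 * P (e x).2 = P x.1 * P x.2)
    {A B C D : (Fin (L + 1) → S) × (Fin L → O) → Prop}
    (h : ∀ x, A x.1 ∧ B x.2 ↔ C (e x).1 ∧ D (e x).2) :
    prob P A * prob P B = prob P C * prob P D := by
  classical
  simp only [prob]
  rw [Finset.sum_mul_sum, Finset.sum_mul_sum, ← Finset.sum_product', ← Finset.sum_product']
  refine Fintype.sum_equiv e _ _ fun x => ?_
  rw [ite_zero_mul_ite_zero, ite_zero_mul_ite_zero, he]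
  exact if_congr (h x) rfl rfl

/-- **Serial and parallel a-posteriori transition distributions coincide.** -/
theorem serial_parallel_APP_transitions
    {S O : Type*} [Fintype S] [Fintype O] [Nonempty S] [Nonempty O]
    [Zero S] [DecidableEq S]
    {N L : ℕ} (hN : 1 ≤ N) (hL : 1 ≤ L)
    -- boundary times 0 = L_0 < L_1 < ⋯ < L_N = L
    (Lb : Fin (N + 1) → Fin (L + 1)) (hmono : StrictMono Lb)
    (hLb0 : Lb 0 = 0) (hLbN : Lb (Fin.last N) = Fin.last L)
    -- the factorizing probability mass function
    (p : S → S → ℝ) (q : O → S → S → ℝ)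
    (hp : ∀ a b, 0 ≤ p a b) (hq : ∀ o a b, 0 ≤ q o a b)
    (P : (Fin (L + 1) → S) × (Fin L → O) → ℝ)
    (hP : ∀ s y, P (s, y) =
      (if s 0 = 0 then (1 : ℝ) else 0) *
        ∏ t : Fin L, p (s t.castSucc) (s t.succ) * q (y t) (s t.castSucc) (s t.succ))
    (hsum : ∑ sy : (Fin (L + 1) → S) × (Fin L → O), P sy = 1)
    -- termination: each parallel codeword drives the encoder back to state 0
    (hterm : ∀ s y, P (s, y) ≠ 0 → ∀ i : Fin (N + 1), s (Lb i) = 0)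
    -- the pair of states
    (m' m : S)
    -- the observation sequence, with positive serial probability
    (y : Fin L → O)
    (hy : 0 < prob P (fun sy => sy.2 = y))
    -- the time t (as an element of Fin L, representing time t+1) and its segment index
    (t : Fin L) (i : Fin N)
    (hti : ((Lb i.castSucc : ℕ) < (t : ℕ) + 1) ∧ ((t : ℕ) + 1 ≤ (Lb i.succ : ℕ))) :
    condProb P (fun sy => sy.1 t.castSucc = m' ∧ sy.1 t.succ = m) (fun sy => sy.2 = y) =
      condProb P (fun sy => sy.1 t.castSucc = m' ∧ sy.1 t.succ = m)
        (fun sy => ∀ k : Fin L,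
          (Lb i.castSucc : ℕ) < (k : ℕ) + 1 → (k : ℕ) + 1 ≤ (Lb i.succ : ℕ) →
            sy.2 k = y k) := by
  obtain ⟨hat, htb⟩ := hti
  have hP0 : ∀ x, 0 ≤ P x := by
    rintro ⟨s, y'⟩
    rw [hP]
    exact mul_nonneg (by split_ifs <;> norm_num)
      (Finset.prod_nonneg fun t _ => mul_nonneg (hp _ _) (hq _ _ _))
  have hpar : 0 < prob P (fun sy => ∀ k : Fin L,
      (Lb i.castSucc : ℕ) < (k : ℕ) + 1 → (k : ℕ) + 1 ≤ (Lb i.succ : ℕ) → sy.2 k = y k) := by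
    refine hy.trans_le (Finset.sum_le_sum fun x _ => ?_)
    split_ifs with h₁ h₂
    · exact le_rfl
    · exact absurd (fun k _ _ => congrFun h₁ k) h₂
    · exact hP0 x
    · exact le_rfl
  set a := Lb i.castSucc
  set b := Lb i.succ
  have hab : a ≤ b := by omega
  have hzero : ∀ u v, P u * P v ≠ 0 → u.1 a = v.1 a ∧ u.1 b = v.1 b := by
    intro u v h
    have hu := hterm u.1 u.2 (left_ne_zero_of_mul h)
    have hv := hterm v.1 v.2 (right_ne_zero_of_mul h)
    exact ⟨(hu _).trans (hv _).symm, (hu _).trans (hv _).symm⟩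
  have hswap : ∀ u v, P (splice a b u v) * P (splice a b v u) = P u * P v := by
    intro u v
    by_cases h : u.1 a = v.1 a ∧ u.1 b = v.1 b
    · exact weight_splice_mul p q P hP a b u v h.1 h.2
    · rw [not_imp_comm.1 (hzero u v) h, not_imp_comm.1 (hzero _ _)]
      simpa [splice, hab] using h
  rw [condProb, condProb, div_eq_div_iff hy.ne' hpar.ne']
  refine prob_mul_prob_of_perm P (spliceEquiv a b) (fun x => hswap x.1 x.2) ?_
  rintro ⟨u, v⟩
  have hA : ∀ j : Fin (L + 1), (a : ℕ) ≤ j → (j : ℕ) ≤ b → (splice a b u v).1 j = u.1 j :=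
    fun j h₁ h₂ => if_pos ⟨h₁, h₂⟩
  have hcast := hA t.castSucc (by simp only [Fin.val_castSucc]; omega)
    (by simp only [Fin.val_castSucc]; omega)
  have hsucc := hA t.succ (by simp only [Fin.val_succ]; omega)
    (by simp only [Fin.val_succ]; omega)
  have hobs : (u.2 = y ∧ ∀ k : Fin L, (a : ℕ) < (k : ℕ) + 1 → (k : ℕ) + 1 ≤ b → v.2 k = y k) ↔
      (∀ k : Fin L, (a : ℕ) < (k : ℕ) + 1 → (k : ℕ) + 1 ≤ b → (splice a b u v).2 k = y k) ∧
        (splice a b v u).2 = y := by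
    simp only [splice, funext_iff]
    grind
  change ((_ ∧ _) ∧ _) ∧ _ ↔
    (((splice a b u v).1 t.castSucc = m' ∧ (splice a b u v).1 t.succ = m) ∧ _) ∧ _
  rw [hcast, hsucc]
  exact and_assoc.trans ((and_congr_right' hobs).trans and_assoc.symm)
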